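/- Let ∼ be a closed equivalence relation on the set R of rays of T'_m, let q≥1, and let p∈[0,1] be such that θ¹(p,q)=0. Then R^∼_{p,q} comprises the singleton measure φ_π only. -/

import Mathlib

namespace RCTree

abbrev Edge (m : ℕ) := Fin (m + 1) × List (Fin m)
abbrev V (m : ℕ) := Option (Edge m)
abbrev Ray (m : ℕ) := Fin (m + 1) × (ℕ → Fin m)
abbrev Config (m : ℕ) := Edge m → Bool

variable {m : ℕ}

/-- The vertex at the top (towards the root) of an edge. -/
def parentV (e : Edge m) : V m :=
  if e.2 = [] then none else some (e.1, e.2.dropLast)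

/-- The vertex at the bottom (away from the root) of an edge. -/
def childV (e : Edge m) : V m := some e

/-- The (undirected) edge `e` has endvertices `u` and `v`. -/
def EndsAt (e : Edge m) (u v : V m) : Prop :=
  (parentV e = u ∧ childV e = v) ∨ (parentV e = v ∧ childV e = u)

/-- The `n`-th edge of a ray from the root. -/
def rayEdge (ρ : Ray m) (n : ℕ) : Edge m := (ρ.1, List.ofFn fun k : Fin n => ρ.2 k)

/-- The `n`-th vertex of a ray from the root. -/
def rayVtx (ρ : Ray m) : ℕ → V m
  | 0 => none
  | n + 1 => some (rayEdge ρ n)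

def rayEdges (ρ : Ray m) : Set (Edge m) := Set.range (rayEdge ρ)

/-- The ray `ρ` passes through the vertex `v`. -/
def RayThrough (ρ : Ray m) (v : V m) : Prop := ∃ n, rayVtx ρ n = v

/-- All edges of the ray `ρ` are open in `ω`. -/
def OpenRay (ω : Config m) (ρ : Ray m) : Prop := ∀ n, ω (rayEdge ρ n) = true

/-- An infinite self-avoiding (undirected) path with endpoint `x`. -/
structure IPath (m : ℕ) (x : V m) where
  vtx : ℕ → V m
  start : vtx 0 = x
  inj : Function.Injective vtx
  adj : ∀ n, ∃ e : Edge m, EndsAt e (vtx n) (vtx (n + 1))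

/-- The edges traversed by an infinite path. -/
def IPath.edges {x : V m} (π : IPath m x) : Set (Edge m) :=
  {e | ∃ n, EndsAt e (π.vtx n) (π.vtx (n + 1))}

/-- A path is forward (an `x`-ray) if it is directed away from the root. -/
def IPath.Forward {x : V m} (π : IPath m x) : Prop :=
  ∀ n, ∃ e : Edge m, parentV e = π.vtx n ∧ childV e = π.vtx (n + 1)

/-- All edges of the path `π` are open in `ω`. -/
def OpenPath {x : V m} (ω : Config m) (π : IPath m x) : Prop :=
  ∀ e ∈ π.edges, ω e = true

/-- The path `π` and the `0`-ray `ρ` differ in only finitely many edges: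
`ρ` is the `0`-ray associated with `π`. -/
def Assoc {x : V m} (π : IPath m x) (ρ : Ray m) : Prop :=
  ((IPath.edges π \ rayEdges ρ) ∪ (rayEdges ρ \ IPath.edges π)).Finite

/-- The set of edges with both endvertices in `Λ`. -/
def ELam (Λ : Set (V m)) : Set (Edge m) :=
  {e | parentV e ∈ Λ ∧ childV e ∈ Λ}

/-- The event `K^S_{u,v,Λ}`: there exist vertex-disjoint open infinite paths from `u` and
from `v`, edge-disjoint from `E_Λ`, whose associated `0`-rays are `S`-related. -/
def KEvent (S : Ray m → Ray m → Prop) (Λ : Set (V m)) (u v : V m) : Set (Config m) :=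
  {ω | ∃ (πu : IPath m u) (πv : IPath m v),
      (∀ a b, πu.vtx a ≠ πv.vtx b) ∧
      OpenPath ω πu ∧ OpenPath ω πv ∧
      (∀ e ∈ πu.edges, e ∉ ELam Λ) ∧ (∀ e ∈ πv.edges, e ∉ ELam Λ) ∧
      ∃ ρu ρv : Ray m, Assoc πu ρu ∧ Assoc πv ρv ∧ S ρu ρv}

/-- The event `A^S_{u,v}`: there exist open `u`- and `v`-rays whose associated
`0`-rays are `S`-related. -/
def AEvent (S : Ray m → Ray m → Prop) (u v : V m) : Set (Config m) :=
  {ω | ∃ (πu : IPath m u) (πv : IPath m v),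
      πu.Forward ∧ πv.Forward ∧ OpenPath ω πu ∧ OpenPath ω πv ∧
      ∃ ρu ρv : Ray m, Assoc πu ρu ∧ Assoc πv ρv ∧ S ρu ρv}

/-- The event `A'^S_{u,v}`: there exist open `0`-rays through `u` and through `v`
that are `S`-related. -/
def APrimeEvent (S : Ray m → Ray m → Prop) (u v : V m) : Set (Config m) :=
  {ω | ∃ ρu ρv : Ray m, RayThrough ρu u ∧ RayThrough ρv v ∧
      OpenRay ω ρu ∧ OpenRay ω ρv ∧ S ρu ρv}

/-- `u` lies on the (unique) path of the tree from the root to `v` (ancestor-or-equal). -/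
def Anc : V m → V m → Prop
  | none, _ => True
  | some _, none => False
  | some e, some f => e.1 = f.1 ∧ e.2 <+: f.2

/-- Two vertices are comparable if one lies on the path from the root to the other. -/
def Comparable (u v : V m) : Prop := Anc u v ∨ Anc v u

/-- `W` is a cutset: it is incomparable (no ray contains more than one member of `W`)
and every ray contains some member of `W`. -/
def IsCutset (W : Set (V m)) : Prop :=
  (∀ (ρ : Ray m) (u v : V m), u ∈ W → v ∈ W → RayThrough ρ u → RayThrough ρ v → u = v) ∧
  ∀ ρ : Ray m, ∃ v ∈ W, RayThrough ρ v

noncomputable section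
open scoped ENNReal
open Classical MeasureTheory

variable {m : ℕ}

/-- The finite set of edges with both endvertices in the finite vertex set `Λ`. -/
def EdgeFinset (Λ : Finset (V m)) : Finset (Edge m) :=
  (Λ.preimage (childV) (Option.some_injective _).injOn).filter fun e => parentV e ∈ Λ

/-- The set `Ω^ξ_Λ` of configurations agreeing with `ξ` off `E_Λ`. -/
def cylinderSet (Λ : Finset (V m)) (ξ : Config m) : Set (Config m) :=
  {ω | ∀ e, e ∉ ELam (↑Λ : Set (V m)) → ω e = ξ e}

/-- `u` and `v` are joined by an `ω`-open path using no edge of `E_Λ`. -/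
def OutConn (Λ : Set (V m)) (ω : Config m) (u v : V m) : Prop :=
  ∃ (n : ℕ) (f : ℕ → V m), f 0 = u ∧ f n = v ∧
    ∀ i < n, ∃ e : Edge m, ω e = true ∧ e ∉ ELam Λ ∧ EndsAt e (f i) (f (i + 1))

/-- The adjacency used to count clusters: open edges of `E_Λ` together with the
augmentation rules (a) and (b). -/
def augRel (S : Ray m → Ray m → Prop) (Λ : Finset (V m)) (ω : Config m) (u v : V m) : Prop :=
  (∃ e ∈ ELam (↑Λ : Set (V m)), ω e = true ∧ EndsAt e u v) ∨
    OutConn (↑Λ : Set (V m)) ω u v ∨ ω ∈ KEvent S (↑Λ : Set (V m)) u v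

/-- The number `k^{ξ,∼}(Λ,ω)` of connected components of the augmented open graph on `Λ`
(for `ω` agreeing with `ξ` off `E_Λ`, the boundary condition is read off from `ω` itself). -/
def kCount (S : Ray m → Ray m → Prop) (Λ : Finset (V m)) (ω : Config m) : ℕ :=
  Nat.card (SimpleGraph.fromRel fun u v : {x // x ∈ Λ} => augRel S Λ ω ↑u ↑v).ConnectedComponent

/-- The random-cluster weight of a configuration. -/
def rcWeight (S : Ray m → Ray m → Prop) (p q : ℝ) (Λ : Finset (V m)) (ω : Config m) : ℝ≥0∞ :=
  (∏ e ∈ EdgeFinset Λ, ENNReal.ofReal (if ω e then p else 1 - p)) *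
    ENNReal.ofReal q ^ kCount S Λ ω

/-- The unnormalised random-cluster measure on `Λ` with boundary condition `ξ`. -/
def rcUnnorm (S : Ray m → Ray m → Prop) (p q : ℝ) (Λ : Finset (V m)) (ξ : Config m) :
    Measure (Config m) :=
  Measure.sum fun ω : {ω : Config m // ω ∈ cylinderSet Λ ξ} =>
    rcWeight S p q Λ (ω : Config m) • Measure.dirac (ω : Config m)

/-- The finite-volume random-cluster measure `φ^{ξ,∼}_{Λ,p,q}`. -/
def rcFin (S : Ray m → Ray m → Prop) (p q : ℝ) (Λ : Finset (V m)) (ξ : Config m) :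
    Measure (Config m) :=
  (rcUnnorm S p q Λ ξ Set.univ)⁻¹ • rcUnnorm S p q Λ ξ

/-- The σ-field `T_Λ` generated by the states of edges not in `E_Λ`. -/
def outSigma (Λ : Finset (V m)) : MeasurableSpace (Config m) :=
  MeasurableSpace.comap (fun ω (e : {e : Edge m // e ∉ EdgeFinset Λ}) => ω ↑e) inferInstance

/-- The set `R^∼_{p,q}` of `(∼)`random-cluster measures: probability measures whose
conditional measure given `T_Λ` at `ξ` is `φ^{ξ,∼}_{Λ,p,q}`, for every finite `Λ`. -/
def RCSet (S : Ray m → Ray m → Prop) (p q : ℝ) : Set (Measure (Config m)) :=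
  {φ | IsProbabilityMeasure φ ∧
    ∀ (Λ : Finset (V m)) (A : Set (Config m)), MeasurableSet A →
      ∀ B : Set (Config m), MeasurableSet[outSigma Λ] B →
        φ (A ∩ B) = ∫⁻ ξ in B, rcFin S p q Λ ξ A ∂φ}

/-- Weak convergence of the finite-volume measures as `Λ ↑ V`. -/
def WeakLim (μs : Finset (V m) → Measure (Config m)) (φ : Measure (Config m)) : Prop :=
  ∀ f : BoundedContinuousFunction (Config m) ℝ,
    Filter.Tendsto (fun Λ => ∫ ω, f ω ∂(μs Λ)) Filter.atTop (nhds (∫ ω, f ω ∂φ))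

/-- `μ` is the Bernoulli product measure with density `r` on the edges. -/
def IsBernoulliProduct (r : ℝ) (μ : Measure (Config m)) : Prop :=
  IsProbabilityMeasure μ ∧
    ∀ (s : Finset (Edge m)) (σ : Config m),
      μ {ω | ∀ e ∈ s, ω e = σ e} = ∏ e ∈ s, ENNReal.ofReal (if σ e then r else 1 - r)

/-- An increasing event. -/
def IncreasingEvent (A : Set (Config m)) : Prop :=
  ∀ ω ω' : Config m, (∀ e, ω e = true → ω' e = true) → ω ∈ A → ω' ∈ A

/-- Stochastic ordering of measures on the configuration space. -/
def StochLE (μ ν : Measure (Config m)) : Prop :=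
  ∀ A : Set (Config m), MeasurableSet A → IncreasingEvent A → μ A ≤ ν A

/-- The wired equivalence relation: all rays are equivalent. -/
def wiredRel (m : ℕ) : Ray m → Ray m → Prop := fun _ _ => True

/-- The all-open boundary configuration. -/
def oneCfg (m : ℕ) : Config m := fun _ => true

/-- `S`, viewed as a subset of `R × R`, is closed. -/
def IsClosedRel (S : Ray m → Ray m → Prop) : Prop :=
  IsClosed {x : Ray m × Ray m | S x.1 x.2}

/-- The closure of the relation `S`: the intersection of all closed equivalence
relations containing `S`. -/
def closureRel (S : Ray m → Ray m → Prop) : Ray m → Ray m → Prop := fun a b =>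
  ∀ T : Ray m → Ray m → Prop, Equivalence T → IsClosedRel T → (∀ x y, S x y → T x y) → T a b

end

open MeasureTheory Filter
open scoped ENNReal

/-! ### Counting connected components by linear algebra -/

/-- The space of rational functions that are constant along the relation `r`. -/
def relSpace {ι : Type*} (r : ι → ι → Prop) : Submodule ℚ (ι → ℚ) where
  carrier := {f | ∀ u v, r u v → f u = f v}
  add_mem' hf hg u v h := by simp [hf u v h, hg u v h]
  zero_mem' _ _ _ := rfl
  smul_mem' c f hf u v h := by simp [hf u v h]

lemma mem_relSpace {ι : Type*} {r : ι → ι → Prop} {f : ι → ℚ} :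
    f ∈ relSpace r ↔ ∀ u v, r u v → f u = f v := Iff.rfl

lemma relSpace_or {ι : Type*} (r s : ι → ι → Prop) :
    relSpace (fun u v => r u v ∨ s u v) = relSpace r ⊓ relSpace s := by
  ext f
  simp only [Submodule.mem_inf, mem_relSpace]
  grind

lemma relSpace_anti {ι : Type*} {r s : ι → ι → Prop} (h : ∀ u v, r u v → s u v) :
    relSpace s ≤ relSpace r := fun _ hf u v huv => hf u v (h u v huv)

lemma card_connectedComponent_fromRel {ι : Type*} [Finite ι] (r : ι → ι → Prop) :
    Nat.card (SimpleGraph.fromRel r).ConnectedComponent = Module.finrank ℚ (relSpace r) := by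
  set G := SimpleGraph.fromRel r
  have : Fintype G.ConnectedComponent := Fintype.ofFinite _
  let L : (G.ConnectedComponent → ℚ) →ₗ[ℚ] (ι → ℚ) := LinearMap.funLeft ℚ ℚ G.connectedComponentMk
  have hL : Function.Injective L :=
    LinearMap.funLeft_injective_of_surjective _ _ _ Quot.mk_surjective
  have hrange : LinearMap.range L = relSpace r := by
    ext f
    constructor
    · rintro ⟨g, rfl⟩ u v huv
      change g _ = g _
      congr 1
      by_cases h : u = v
      · rw [h]
      · exact SimpleGraph.ConnectedComponent.sound
          (SimpleGraph.Adj.reachable ((SimpleGraph.fromRel_adj r u v).2 ⟨h, Or.inl huv⟩))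
    · intro hf
      have hwalk : ∀ u v (w : G.Walk u v), f u = f v := by
        intro u v w
        induction w with
        | nil => rfl
        | cons h _ ih =>
          rw [← ih]
          rcases ((SimpleGraph.fromRel_adj r _ _).1 h).2 with h | h
          · exact hf _ _ h
          · exact (hf _ _ h).symm
      refine ⟨fun c => c.lift f fun u v w _ => hwalk u v w, ?_⟩
      rfl
  rw [← hrange, LinearMap.finrank_range_of_inj hL, Module.finrank_fintype_fun_eq_card,
    Nat.card_eq_fintype_card]

/-! ### Finite-volume weights with a general boundary relation -/

/-- Configurations on the edges of `E_Λ`. -/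
abbrev LocalCfg (Λ : Finset (V m)) := {e // e ∈ EdgeFinset Λ} → Bool

lemma mem_edgeFinset {Λ : Finset (V m)} {e : Edge m} :
    e ∈ EdgeFinset Λ ↔ e ∈ ELam (↑Λ : Set (V m)) := by
  rw [EdgeFinset, Finset.mem_filter]
  exact (and_congr_left' Finset.mem_preimage).trans and_comm

/-- Two vertices of `Λ` are joined by an edge of `E_Λ` that is open in `σ`. -/
def edgeRel {Λ : Finset (V m)} (σ : LocalCfg Λ) (u v : {x // x ∈ Λ}) : Prop :=
  ∃ e : {e // e ∈ EdgeFinset Λ}, σ e = true ∧ EndsAt e.1 ↑u ↑v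

/-- The relation `R` on vertices, restricted to `Λ`. -/
def bdryRel (R : V m → V m → Prop) (Λ : Finset (V m)) (u v : {x // x ∈ Λ}) : Prop := R ↑u ↑v

/-- The number of clusters of `σ` when vertices related by the boundary relation `R` are
identified. -/
noncomputable def clusterCount (R : V m → V m → Prop) {Λ : Finset (V m)} (σ : LocalCfg Λ) : ℕ :=
  Module.finrank ℚ ↥(relSpace (bdryRel R Λ) ⊓ relSpace (edgeRel σ))

/-- The random-cluster weight of `σ` with boundary relation `R`. -/
noncomputable def bdryWeight (R : V m → V m → Prop) (p q : ℝ) {Λ : Finset (V m)}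
    (σ : LocalCfg Λ) : ℝ :=
  (∏ e, if σ e then p else 1 - p) * q ^ clusterCount R σ

/-- The random-cluster probability of `T` with boundary relation `R`. -/
noncomputable def bdryProb (R : V m → V m → Prop) (p q : ℝ) {Λ : Finset (V m)}
    (T : Set (LocalCfg Λ)) : ℝ :=
  (∑ σ, T.indicator (bdryWeight R p q) σ) / ∑ σ : LocalCfg Λ, bdryWeight R p q σ

lemma relSpace_edgeRel_anti {Λ : Finset (V m)} {σ τ : LocalCfg Λ} (h : σ ≤ τ) :
    relSpace (edgeRel τ) ≤ relSpace (edgeRel σ) :=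
  relSpace_anti fun _ _ ⟨e, he, huv⟩ => ⟨e, top_le_iff.1 (he.symm.trans_le (h e)), huv⟩

lemma relSpace_edgeRel_sup {Λ : Finset (V m)} (σ τ : LocalCfg Λ) :
    relSpace (edgeRel (σ ⊔ τ)) = relSpace (edgeRel σ) ⊓ relSpace (edgeRel τ) := by
  rw [← relSpace_or]
  congr! 3 with u v
  simp only [edgeRel, Pi.sup_apply, ← exists_or, ← or_and_right]
  congr! 3 with e
  cases σ e <;> cases τ e <;> simp

lemma clusterCount_add_le {R R' : V m → V m → Prop} (hR : ∀ u v, R u v → R' u v)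
    {Λ : Finset (V m)} (σ τ : LocalCfg Λ) :
    clusterCount R σ + clusterCount R' τ ≤ clusterCount R (σ ⊓ τ) + clusterCount R' (σ ⊔ τ) := by
  have hX : relSpace (bdryRel R' Λ) ≤ relSpace (bdryRel R Λ) := relSpace_anti fun u v h => hR _ _ h
  unfold clusterCount
  rw [← Submodule.finrank_sup_add_finrank_inf_eq, relSpace_edgeRel_sup]
  refine add_le_add (Submodule.finrank_mono (sup_le ?_ ?_)) (Submodule.finrank_mono ?_)
  · exact inf_le_inf_left _ (relSpace_edgeRel_anti inf_le_left)
  · exact inf_le_inf hX (relSpace_edgeRel_anti inf_le_right)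
  · exact le_inf (inf_le_right.trans inf_le_left)
      (le_inf (inf_le_left.trans inf_le_right) (inf_le_right.trans inf_le_right))

section Weights
variable {p q : ℝ} {Λ : Finset (V m)}

lemma bdryWeight_nonneg (hp0 : 0 ≤ p) (hp1 : p ≤ 1) (hq : 1 ≤ q) (R : V m → V m → Prop)
    (σ : LocalCfg Λ) : 0 ≤ bdryWeight R p q σ := by
  refine mul_nonneg (Finset.prod_nonneg fun e _ => ?_) (by positivity)
  split_ifs <;> linarith

lemma bdryWeight_mul_le (hp0 : 0 ≤ p) (hp1 : p ≤ 1) (hq : 1 ≤ q) {R R' : V m → V m → Prop}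
    (hR : ∀ u v, R u v → R' u v) (σ τ : LocalCfg Λ) :
    bdryWeight R p q σ * bdryWeight R' p q τ ≤
      bdryWeight R p q (σ ⊓ τ) * bdryWeight R' p q (σ ⊔ τ) := by
  unfold bdryWeight
  rw [mul_mul_mul_comm _ (q ^ clusterCount R σ), mul_mul_mul_comm _ (q ^ clusterCount R (σ ⊓ τ)),
    ← Finset.prod_mul_distrib, ← Finset.prod_mul_distrib,
    ← pow_add, ← pow_add]
  have hprod : ∀ e, (if σ e then p else 1 - p) * (if τ e then p else 1 - p) =
      (if (σ ⊓ τ) e then p else 1 - p) * (if (σ ⊔ τ) e then p else 1 - p) := by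
    intro e
    simp only [Pi.inf_apply, Pi.sup_apply]
    rcases Bool.eq_false_or_eq_true (σ e) with hs | hs <;>
      rcases Bool.eq_false_or_eq_true (τ e) with ht | ht <;> simp [hs, ht, mul_comm]
  simp_rw [hprod]
  refine mul_le_mul_of_nonneg_left (pow_le_pow_right₀ hq (clusterCount_add_le hR σ τ))
    (Finset.prod_nonneg fun e _ => mul_nonneg ?_ ?_) <;> split_ifs <;> linarith

lemma sum_bdryWeight_pos (hp0 : 0 ≤ p) (hp1 : p ≤ 1) (hq : 1 ≤ q) (R : V m → V m → Prop) :
    0 < ∑ σ : LocalCfg Λ, bdryWeight R p q σ := by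
  have key : ∃ b : Bool, 0 < if b then p else 1 - p := by
    rcases hp0.eq_or_lt with h | h
    · exact ⟨false, by simp [← h]⟩
    · exact ⟨true, by simpa using h⟩
  obtain ⟨b, hb⟩ := key
  refine Finset.sum_pos' (fun σ _ => bdryWeight_nonneg hp0 hp1 hq R σ)
    ⟨fun _ => b, Finset.mem_univ _, ?_⟩
  exact mul_pos (Finset.prod_pos fun _ _ => hb) (by positivity)

lemma bdryProb_nonneg (hp0 : 0 ≤ p) (hp1 : p ≤ 1) (hq : 1 ≤ q) (R : V m → V m → Prop)
    (T : Set (LocalCfg Λ)) : 0 ≤ bdryProb R p q T :=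
  div_nonneg (Finset.sum_nonneg fun σ _ =>
    Set.indicator_nonneg (fun _ _ => bdryWeight_nonneg hp0 hp1 hq R _) σ)
    (sum_bdryWeight_pos hp0 hp1 hq R).le

lemma bdryProb_univ (hp0 : 0 ≤ p) (hp1 : p ≤ 1) (hq : 1 ≤ q) (R : V m → V m → Prop) :
    bdryProb R p q (Set.univ : Set (LocalCfg Λ)) = 1 := by
  simp only [bdryProb, Set.indicator_univ]
  exact div_self (sum_bdryWeight_pos hp0 hp1 hq R).ne'

lemma bdryProb_mul_le (hp0 : 0 ≤ p) (hp1 : p ≤ 1) (hq : 1 ≤ q) {R R' : V m → V m → Prop}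
    (hR : ∀ u v, R u v → R' u v) {T T' : Set (LocalCfg Λ)} (hT : IsUpperSet T)
    (hT' : IsUpperSet T') :
    bdryProb R p q T * bdryProb R' p q T' ≤ bdryProb R' p q (T ∩ T') := by
  have hw := bdryWeight_nonneg (Λ := Λ) hp0 hp1 hq
  have hZ := sum_bdryWeight_pos (Λ := Λ) hp0 hp1 hq R
  have hZ' := sum_bdryWeight_pos (Λ := Λ) hp0 hp1 hq R'
  have h := four_functions_theorem_univ (T.indicator (bdryWeight R p q))
    (T'.indicator (bdryWeight R' p q)) (bdryWeight R p q)
    ((T ∩ T').indicator (bdryWeight R' p q))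
    (Set.indicator_nonneg fun _ _ => hw R _) (Set.indicator_nonneg fun _ _ => hw R' _)
    (hw R) (Set.indicator_nonneg fun _ _ => hw R' _) (by
      intro σ τ
      by_cases hσ : σ ∈ T
      · by_cases hτ : τ ∈ T'
        · have : σ ⊔ τ ∈ T ∩ T' := ⟨hT le_sup_left hσ, hT' le_sup_right hτ⟩
          rw [Set.indicator_of_mem hσ, Set.indicator_of_mem hτ, Set.indicator_of_mem this]
          exact bdryWeight_mul_le hp0 hp1 hq hR σ τ
        · rw [Set.indicator_of_notMem hτ, mul_zero]
          exact mul_nonneg (hw R _) (Set.indicator_nonneg (fun _ _ => hw R' _) _)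
      · rw [Set.indicator_of_notMem hσ, zero_mul]
        exact mul_nonneg (hw R _) (Set.indicator_nonneg (fun _ _ => hw R' _) _))
  unfold bdryProb
  rw [div_mul_div_comm, div_le_div_iff₀ (mul_pos hZ hZ') hZ']
  nlinarith [mul_le_mul_of_nonneg_right h hZ'.le]

end Weights

/-! ### Boundary relations that create no cycle -/

lemma anc_self (e : Edge m) : Anc (some e) (childV e) := ⟨rfl, List.prefix_rfl⟩

lemma not_anc_parentV (e : Edge m) : ¬ Anc (some e) (parentV e) := by
  unfold parentV
  split_ifs with h
  · exact fun h => h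
  · rintro ⟨-, h'⟩
    have := h'.length_le
    have := List.length_pos_of_ne_nil h
    simp at *
    omega

lemma anc_endsAt_iff {e f : Edge m} (hne : f ≠ e) {u v : V m} (h : EndsAt f u v) :
    Anc (some e) u ↔ Anc (some e) v := by
  have key : Anc (some e) (parentV f) ↔ Anc (some e) (childV f) := by
    obtain ⟨i, l⟩ := f
    obtain ⟨j, k⟩ := e
    rcases List.eq_nil_or_concat' l with rfl | ⟨l, a, rfl⟩
    · simp only [parentV, childV, Anc, if_true, List.prefix_nil, false_iff]
      rintro ⟨rfl, rfl⟩
      exact hne rfl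
    · simp only [parentV, childV, Anc, List.append_eq_nil_iff, List.cons_ne_self, and_false,
        if_false, List.dropLast_concat, List.prefix_concat_iff]
      constructor
      · exact fun h => ⟨h.1, Or.inr h.2⟩
      · rintro ⟨rfl, rfl | h⟩
        · exact absurd rfl hne
        · exact ⟨rfl, h⟩
  rcases h with ⟨rfl, rfl⟩ | ⟨rfl, rfl⟩
  · exact key
  · exact key.symm

/-- The boundary relation `R` never relates two vertices separated by an edge of `E_Λ`. -/
def Acyclic (R : V m → V m → Prop) (Λ : Finset (V m)) : Prop :=
  ∀ e ∈ EdgeFinset Λ, ∀ u v, R u v → (Anc (some e) u ↔ Anc (some e) v)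

section Bernoulli
variable {p q : ℝ} {Λ : Finset (V m)}

/-- The upper endvertex of an edge of `E_Λ`, as an element of `Λ`. -/
def topV (e : {e // e ∈ EdgeFinset Λ}) : {x // x ∈ Λ} := ⟨parentV e.1, (mem_edgeFinset.1 e.2).1⟩

/-- The lower endvertex of an edge of `E_Λ`, as an element of `Λ`. -/
def botV (e : {e // e ∈ EdgeFinset Λ}) : {x // x ∈ Λ} := ⟨childV e.1, (mem_edgeFinset.1 e.2).2⟩

/-- The increments of a function along the open edges of `σ`. -/
def incr (σ : LocalCfg Λ) :
    ({x // x ∈ Λ} → ℚ) →ₗ[ℚ] ({e // σ e = true} → ℚ) where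
  toFun f e := f (botV e.1) - f (topV e.1)
  map_add' f g := by ext e; simp; ring
  map_smul' c f := by ext e; simp; ring

lemma ker_incr (σ : LocalCfg Λ) : LinearMap.ker (incr σ) = relSpace (edgeRel σ) := by
  ext f
  rw [LinearMap.mem_ker, mem_relSpace]
  constructor
  · rintro h u v ⟨e, he, huv⟩
    have h1 : f (botV e) = f (topV e) := sub_eq_zero.1 (congrFun h ⟨e, he⟩)
    rcases huv with ⟨hu, hv⟩ | ⟨hv, hu⟩
    · rw [show u = topV e from Subtype.ext hu.symm, show v = botV e from Subtype.ext hv.symm, h1]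
    · rw [show v = topV e from Subtype.ext hv.symm, show u = botV e from Subtype.ext hu.symm, h1]
  · intro h
    ext e
    exact sub_eq_zero.2 (h _ _ ⟨e.1, e.2, Or.inr ⟨rfl, rfl⟩⟩)

open Classical in
lemma clusterCount_add_card {R : V m → V m → Prop} (hR : Acyclic R Λ) (σ : LocalCfg Λ) :
    clusterCount R σ + Fintype.card {e // σ e = true} =
      Module.finrank ℚ (relSpace (bdryRel R Λ)) := by
  set X := relSpace (bdryRel R Λ)
  set D := (incr σ).comp X.subtype
  have hsurj : LinearMap.range D = ⊤ := by
    rw [LinearMap.range_eq_top]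
    intro g
    let f : {x // x ∈ Λ} → ℚ := fun v =>
      ∑ e : {e // σ e = true}, g e * if Anc (some e.1.1) ↑v then 1 else 0
    have hf : f ∈ X := fun u v huv =>
      Finset.sum_congr rfl fun e _ => by simp only [hR _ e.1.2 _ _ huv]
    refine ⟨⟨f, hf⟩, ?_⟩
    ext e
    change f (botV e.1) - f (topV e.1) = g e
    rw [← Finset.sum_sub_distrib, Finset.sum_eq_single e]
    · simp [botV, topV, anc_self, not_anc_parentV]
    · intro e' _ hne
      have : Anc (some e'.1.1) (botV e.1).1 ↔ Anc (some e'.1.1) (topV e.1).1 :=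
        anc_endsAt_iff (f := e.1.1) (fun h => hne (Subtype.ext (Subtype.ext h.symm)))
          (Or.inr ⟨rfl, rfl⟩)
      simp [this]
    · simp
  have h := D.finrank_range_add_finrank_ker
  rw [hsurj, finrank_top, Module.finrank_fintype_fun_eq_card, LinearMap.ker_comp, ker_incr] at h
  rw [← h, add_comm, clusterCount, ← Submodule.map_comap_subtype,
    Submodule.finrank_map_subtype_eq]

/-- The Bernoulli weight with density `r` of a local configuration. -/
noncomputable def bernWeight (r : ℝ) (σ : LocalCfg Λ) : ℝ := ∏ e, if σ e then r else 1 - r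

lemma sum_bernWeight (r : ℝ) : ∑ σ : LocalCfg Λ, bernWeight r σ = 1 := by
  unfold bernWeight
  rw [← Fintype.prod_sum (fun (_ : {e // e ∈ EdgeFinset Λ}) (b : Bool) => if b then r else 1 - r)]
  simp

lemma bernWeight_nonneg {r : ℝ} (h0 : 0 ≤ r) (h1 : r ≤ 1) (σ : LocalCfg Λ) :
    0 ≤ bernWeight r σ :=
  Finset.prod_nonneg fun e _ => by split_ifs <;> linarith

lemma bdryWeight_of_acyclic (hp1 : p ≤ 1) (hq : 1 ≤ q) {R : V m → V m → Prop}
    (hR : Acyclic R Λ) (σ : LocalCfg Λ) :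
    bdryWeight R p q σ = q ^ Module.finrank ℚ (relSpace (bdryRel R Λ)) *
      ((p + q * (1 - p)) / q) ^ (EdgeFinset Λ).card * bernWeight (p / (p + q * (1 - p))) σ := by
  have hD : 0 < p + q * (1 - p) := by nlinarith
  have hq0 : q ≠ 0 := by positivity
  have hopen : q ^ Fintype.card {e // σ e = true} = ∏ e, if σ e = true then q else 1 := by
    rw [Fintype.card_subtype, ← Finset.prod_const, Finset.prod_filter]
  have hall : ((p + q * (1 - p)) / q) ^ (EdgeFinset Λ).card =
      ∏ _e : {e // e ∈ EdgeFinset Λ}, (p + q * (1 - p)) / q := by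
    rw [Finset.prod_const, Finset.card_univ, Fintype.card_coe]
  rw [← clusterCount_add_card hR σ, pow_add, bdryWeight, bernWeight, hopen, hall, mul_assoc,
    mul_assoc, mul_comm, ← Finset.prod_mul_distrib, ← Finset.prod_mul_distrib]
  congr 1
  refine Finset.prod_congr rfl fun e _ => ?_
  have hcompl : 1 - p / (p + q * (1 - p)) = q * (1 - p) / (p + q * (1 - p)) := by
    rw [eq_div_iff hD.ne', sub_mul, div_mul_cancel₀ _ hD.ne']
    ring
  rw [hcompl]
  generalize p + q * (1 - p) = D at hD
  split_ifs <;> field_simp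

lemma bdryProb_of_acyclic (hp1 : p ≤ 1) (hq : 1 ≤ q) {R : V m → V m → Prop}
    (hR : Acyclic R Λ) (T : Set (LocalCfg Λ)) :
    bdryProb R p q T = ∑ σ, T.indicator (bernWeight (p / (p + q * (1 - p)))) σ := by
  have hD : 0 < p + q * (1 - p) := by nlinarith
  have hC : q ^ Module.finrank ℚ (relSpace (bdryRel R Λ)) *
      ((p + q * (1 - p)) / q) ^ (EdgeFinset Λ).card ≠ 0 := by positivity
  unfold bdryProb
  rw [show bdryWeight (Λ := Λ) R p q = fun σ => _ from
    funext (bdryWeight_of_acyclic hp1 hq hR)]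
  simp_rw [Set.indicator_const_mul]
  rw [← Finset.mul_sum, ← Finset.mul_sum, sum_bernWeight, mul_one, mul_div_cancel_left₀ _ hC]

end Bernoulli

/-! ### The finite-volume measures -/

/-- The configuration equal to `σ` on `E_Λ` and to `ξ` elsewhere. -/
noncomputable def patch {Λ : Finset (V m)} (σ : LocalCfg Λ) (ξ : Config m) : Config m :=
  open Classical in fun e => if h : e ∈ EdgeFinset Λ then σ ⟨e, h⟩ else ξ e

/-- The restriction of a configuration to `E_Λ`. -/
def res (Λ : Finset (V m)) (ω : Config m) : LocalCfg Λ := fun e => ω e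

lemma patch_mem {Λ : Finset (V m)} (σ : LocalCfg Λ) (ξ : Config m) (e : {e // e ∈ EdgeFinset Λ}) :
    patch σ ξ e = σ e := by
  simp [patch]

lemma patch_notMem {Λ : Finset (V m)} (σ : LocalCfg Λ) (ξ : Config m) {e : Edge m}
    (h : e ∉ EdgeFinset Λ) : patch σ ξ e = ξ e := by
  simp [patch, h]

lemma res_patch {Λ : Finset (V m)} (σ : LocalCfg Λ) (ξ : Config m) : res Λ (patch σ ξ) = σ :=
  funext fun e => patch_mem σ ξ e

lemma measurable_patch {Λ : Finset (V m)} (σ : LocalCfg Λ) :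
    Measurable (patch σ : Config m → Config m) := by
  refine measurable_pi_lambda _ fun e => ?_
  by_cases h : e ∈ EdgeFinset Λ
  · simp [patch, h]
  · simpa [patch, h] using measurable_pi_apply e

lemma measurable_res (Λ : Finset (V m)) : Measurable (res Λ) :=
  measurable_pi_lambda _ fun e => measurable_pi_apply e.1

/-- The relation induced on vertices by the configuration outside `E_Λ`. -/
def outRel (S : Ray m → Ray m → Prop) (Λ : Finset (V m)) (ξ : Config m) (u v : V m) : Prop :=
  OutConn (↑Λ : Set (V m)) ξ u v ∨ ξ ∈ KEvent S (↑Λ : Set (V m)) u v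

lemma outRel_mono {S S' : Ray m → Ray m → Prop} (hS : ∀ a b, S a b → S' a b)
    {Λ : Finset (V m)} {ξ ξ' : Config m}
    (h : ∀ e ∉ ELam (↑Λ : Set (V m)), ξ e = true → ξ' e = true) {u v : V m}
    (huv : outRel S Λ ξ u v) : outRel S' Λ ξ' u v := by
  rcases huv with ⟨n, f, h0, hn, hf⟩ | ⟨πu, πv, hd, hu, hv, hu', hv', ρu, ρv, hau, hav, hs⟩
  · refine Or.inl ⟨n, f, h0, hn, fun i hi => ?_⟩
    obtain ⟨e, he, he', hends⟩ := hf i hi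
    exact ⟨e, h e he' he, he', hends⟩
  · exact Or.inr ⟨πu, πv, hd, fun e he => h e (hu' e he) (hu e he),
      fun e he => h e (hv' e he) (hv e he), hu', hv', ρu, ρv, hau, hav, hS _ _ hs⟩

lemma outRel_patch (S : Ray m → Ray m → Prop) {Λ : Finset (V m)} (σ : LocalCfg Λ)
    (ξ : Config m) : outRel S Λ (patch σ ξ) = outRel S Λ ξ := by
  have h : ∀ e ∉ ELam (↑Λ : Set (V m)), patch σ ξ e = ξ e := fun e he =>
    patch_notMem σ ξ (mt mem_edgeFinset.1 he)
  ext u v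
  exact ⟨outRel_mono (fun _ _ => id) fun e he => by rw [h e he]; exact id,
    outRel_mono (fun _ _ => id) fun e he => by rw [h e he]; exact id⟩

lemma kCount_patch (S : Ray m → Ray m → Prop) {Λ : Finset (V m)} (σ : LocalCfg Λ)
    (ξ : Config m) : kCount S Λ (patch σ ξ) = clusterCount (outRel S Λ ξ) σ := by
  have h : (fun u v : {x // x ∈ Λ} => augRel S Λ (patch σ ξ) ↑u ↑v) =
      fun u v => edgeRel σ u v ∨ bdryRel (outRel S Λ ξ) Λ u v := by
    ext u v
    rw [← outRel_patch S σ ξ]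
    refine or_congr ⟨?_, ?_⟩ Iff.rfl
    · rintro ⟨e, he, hop, hends⟩
      exact ⟨⟨e, mem_edgeFinset.2 he⟩, by rwa [← patch_mem σ ξ], hends⟩
    · rintro ⟨e, hop, hends⟩
      exact ⟨e, mem_edgeFinset.1 e.2, by rwa [patch_mem σ ξ], hends⟩
  rw [kCount, h, card_connectedComponent_fromRel, clusterCount, inf_comm, ← relSpace_or]

section FiniteVolume
variable {p q : ℝ} {Λ : Finset (V m)}

lemma rcWeight_patch (hp0 : 0 ≤ p) (hp1 : p ≤ 1) (hq : 1 ≤ q) (S : Ray m → Ray m → Prop)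
    (σ : LocalCfg Λ) (ξ : Config m) :
    rcWeight S p q Λ (patch σ ξ) = ENNReal.ofReal (bdryWeight (outRel S Λ ξ) p q σ) := by
  have hnn : ∀ b : Bool, 0 ≤ if b then p else 1 - p := by
    intro b
    split_ifs <;> linarith
  rw [rcWeight, bdryWeight, ENNReal.ofReal_mul (Finset.prod_nonneg fun _ _ => hnn _),
    ENNReal.ofReal_pow (by linarith), kCount_patch, ← Finset.prod_coe_sort,
    ENNReal.ofReal_prod_of_nonneg fun _ _ => hnn _]
  simp_rw [patch_mem]

/-- A configuration agreeing with `ξ` off `E_Λ` is determined by its restriction to `E_Λ`. -/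
noncomputable def cylinderEquiv (Λ : Finset (V m)) (ξ : Config m) :
    LocalCfg Λ ≃ {ω : Config m // ω ∈ cylinderSet Λ ξ} where
  toFun σ := ⟨patch σ ξ, fun _ he => patch_notMem σ ξ (mt mem_edgeFinset.1 he)⟩
  invFun ω := res Λ ω
  left_inv σ := res_patch σ ξ
  right_inv ω := by
    ext e
    by_cases h : e ∈ EdgeFinset Λ
    · exact patch_mem (res Λ ω) ξ ⟨e, h⟩
    · exact (patch_notMem _ ξ h).trans (ω.2 e (mt mem_edgeFinset.2 h)).symm

lemma rcUnnorm_apply (hp0 : 0 ≤ p) (hp1 : p ≤ 1) (hq : 1 ≤ q) (S : Ray m → Ray m → Prop)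
    (ξ : Config m) (A : Set (Config m)) :
    rcUnnorm S p q Λ ξ A = ENNReal.ofReal
      (∑ σ : LocalCfg Λ, {σ | patch σ ξ ∈ A}.indicator (bdryWeight (outRel S Λ ξ) p q) σ) := by
  have hw := bdryWeight_nonneg (Λ := Λ) hp0 hp1 hq (outRel S Λ ξ)
  have : Countable {ω : Config m // ω ∈ cylinderSet Λ ξ} :=
    (cylinderEquiv Λ ξ).symm.injective.countable
  rw [rcUnnorm, Measure.sum_apply_of_countable, ← (cylinderEquiv Λ ξ).tsum_eq, tsum_fintype,
    ENNReal.ofReal_sum_of_nonneg fun σ _ => Set.indicator_nonneg (fun _ _ => hw _) σ]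
  refine Finset.sum_congr rfl fun σ _ => ?_
  rw [Measure.smul_apply, Measure.dirac_apply, smul_eq_mul]
  change rcWeight S p q Λ (patch σ ξ) * A.indicator 1 (patch σ ξ) = _
  rw [rcWeight_patch hp0 hp1 hq]
  by_cases h : patch σ ξ ∈ A
  · rw [Set.indicator_of_mem h, Set.indicator_of_mem (by exact h), Pi.one_apply, mul_one]
  · rw [Set.indicator_of_notMem h, Set.indicator_of_notMem (by exact h), mul_zero,
      ENNReal.ofReal_zero]

lemma rcFin_apply (hp0 : 0 ≤ p) (hp1 : p ≤ 1) (hq : 1 ≤ q) (S : Ray m → Ray m → Prop)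
    (ξ : Config m) (A : Set (Config m)) :
    rcFin S p q Λ ξ A =
      ENNReal.ofReal (bdryProb (outRel S Λ ξ) p q {σ : LocalCfg Λ | patch σ ξ ∈ A}) := by
  have hZ := sum_bdryWeight_pos (Λ := Λ) hp0 hp1 hq (outRel S Λ ξ)
  rw [rcFin, Measure.smul_apply, rcUnnorm_apply hp0 hp1 hq, rcUnnorm_apply hp0 hp1 hq, bdryProb,
    ENNReal.ofReal_div_of_pos hZ, smul_eq_mul, mul_comm, div_eq_mul_inv]
  simp

lemma rcFin_res (hp0 : 0 ≤ p) (hp1 : p ≤ 1) (hq : 1 ≤ q) (S : Ray m → Ray m → Prop)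
    (ξ : Config m) (T : Set (LocalCfg Λ)) :
    rcFin S p q Λ ξ (res Λ ⁻¹' T) = ENNReal.ofReal (bdryProb (outRel S Λ ξ) p q T) := by
  rw [rcFin_apply hp0 hp1 hq]
  simp [res_patch]

end FiniteVolume

/-! ### Infinite open paths contain long open branches -/

/-- There is an open directed path of length `n` starting at the vertex `(i, w)`. -/
def OpenBranch (i : Fin (m + 1)) (w : List (Fin m)) (n : ℕ) : Set (Config m) :=
  {ω | ∃ l : List (Fin m), l.length = n ∧ ∀ l', l' <+: l → l' ≠ [] → ω (i, w ++ l') = true}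

/-- There is an open directed path of length `n + 1` starting at the root. -/
def RootBranch (m n : ℕ) : Set (Config m) :=
  {ω | ∃ (i : Fin (m + 1)) (l : List (Fin m)), l.length = n ∧ ∀ l', l' <+: l → ω (i, l') = true}

/-- The path from the root to the vertex `(i, w)` is open. -/
def OpenStem (i : Fin (m + 1)) (w : List (Fin m)) : Set (Config m) :=
  {ω | ∀ l', l' <+: w → ω (i, l') = true}

lemma openBranch_inter_openStem_subset (i : Fin (m + 1)) (w : List (Fin m)) (n : ℕ) :
    OpenBranch i w n ∩ OpenStem i w ⊆ RootBranch m (w.length + n) := by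
  rintro ω ⟨⟨l, hl, hω⟩, hw⟩
  refine ⟨i, w ++ l, by simp [hl], fun l' hl' => ?_⟩
  rcases List.prefix_or_prefix_of_prefix hl' (List.prefix_append w l) with h | ⟨t, rfl⟩
  · exact hw _ h
  · by_cases ht : t = []
    · exact hw _ (by simp [ht])
    · exact hω t ((List.prefix_append_right_inj w).1 hl') ht

/-- The distance of a vertex from the root. -/
def depth : V m → ℕ
  | none => 0
  | some e => e.2.length + 1

lemma depth_childV (e : Edge m) : depth (childV e) = depth (parentV e) + 1 := by
  obtain ⟨i, l⟩ := e
  rcases List.eq_nil_or_concat' l with rfl | ⟨l, a, rfl⟩ <;> simp [childV, parentV, depth]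

lemma exists_of_parentV_eq_some {e : Edge m} {i : Fin (m + 1)} {w : List (Fin m)}
    (h : parentV e = some (i, w)) : ∃ a, e = (i, w ++ [a]) := by
  obtain ⟨j, l⟩ := e
  rcases List.eq_nil_or_concat' l with rfl | ⟨l, a, rfl⟩
  · simp [parentV] at h
  · simp only [parentV, List.append_eq_nil_iff, List.cons_ne_self, and_false, if_false,
      List.dropLast_concat, Option.some.injEq, Prod.mk.injEq] at h
    exact ⟨a, by rw [h.1, h.2]⟩

/-- The `n`-th step of the path leads away from the root. -/
def IPath.Down {x : V m} (π : IPath m x) (n : ℕ) : Prop :=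
  ∃ e : Edge m, parentV e = π.vtx n ∧ childV e = π.vtx (n + 1)

lemma IPath.exists_down {x : V m} (π : IPath m x) : ∃ n, π.Down n := by
  by_contra! hup
  have h : ∀ n, depth (π.vtx n) + n = depth (π.vtx 0) := by
    intro n
    induction n with
    | zero => rfl
    | succ n ih =>
      obtain ⟨e, he | he⟩ := π.adj n
      · exact absurd ⟨e, he⟩ (hup n)
      · rw [← ih, ← he.1, ← he.2, depth_childV]
        ring
  have := h (depth (π.vtx 0) + 1)
  omega

lemma IPath.Down.succ {x : V m} {π : IPath m x} {n : ℕ} (h : π.Down n) : π.Down (n + 1) := by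
  obtain ⟨e, he⟩ := h
  obtain ⟨f, hf | hf⟩ := π.adj (n + 1)
  · exact ⟨f, hf⟩
  · have hef : e = f := Option.some_injective _ (he.2.trans hf.2.symm)
    subst hef
    have := π.inj (he.1.symm.trans hf.1)
    omega

lemma IPath.exists_openBranch {x : V m} {π : IPath m x} {ω : Config m} (h : OpenPath ω π) :
    ∃ i w, ∀ n, ω ∈ OpenBranch i w n := by
  obtain ⟨k, hk⟩ := π.exists_down
  have hdown : ∀ n, π.Down (k + n) := by
    intro n
    induction n with
    | zero => exact hk
    | succ n ih => exact ih.succ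
  obtain ⟨⟨i, w⟩, -, hv⟩ := hk
  have key : ∀ n, ∃ l : List (Fin m), l.length = n ∧
      (∀ l', l' <+: l → l' ≠ [] → ω (i, w ++ l') = true) ∧
      π.vtx (k + 1 + n) = some (i, w ++ l) := by
    intro n
    induction n with
    | zero => exact ⟨[], rfl, fun l' hl' hne => absurd (List.prefix_nil.1 hl') hne,
        by simpa [childV] using hv.symm⟩
    | succ n ih =>
      obtain ⟨l, hl, hop, hvl⟩ := ih
      obtain ⟨e, he, he'⟩ := hdown (1 + n)
      rw [← add_assoc] at he he'
      obtain ⟨a, rfl⟩ := exists_of_parentV_eq_some (he.trans hvl)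
      refine ⟨l ++ [a], by simp [hl], fun l' hl' hne => ?_, ?_⟩
      · rcases List.prefix_concat_iff.1 hl' with rfl | hl'
        · rw [← List.append_assoc]
          exact h _ ⟨_, Or.inl ⟨he, he'⟩⟩
        · exact hop l' hl' hne
      · rw [← List.append_assoc]
        exact he'.symm
  exact ⟨i, w, fun n => (key n).imp fun l hl => ⟨hl.1, hl.2.1⟩⟩

lemma ofFn_take_prefix (f : ℕ → Fin m) {j k : ℕ} (h : j ≤ k) :
    (List.ofFn fun i : Fin j => f i) <+: List.ofFn fun i : Fin k => f i := by
  obtain ⟨d, rfl⟩ := Nat.exists_eq_add_of_le h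
  rw [List.ofFn_add]
  exact List.prefix_append _ _

/-- König's lemma. -/
lemma exists_openRay (hm : 2 ≤ m) {ω : Config m} (h : ∀ n, ω ∈ RootBranch m n) :
    ∃ ρ : Ray m, OpenRay ω ρ := by
  let C : ℕ → Set (Ray m) := fun n => ⋂ j ∈ Set.Iic n, {ρ | ω (rayEdge ρ j) = true}
  have hclosed : ∀ n, IsClosed (C n) := by
    intro n
    refine isClosed_biInter fun j _ => ?_
    let g : Ray m → Fin (m + 1) × (Fin j → Fin m) := fun ρ => (ρ.1, fun k => ρ.2 k)
    have hg : Continuous g := by fun_prop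
    exact (isClosed_discrete
      {x : Fin (m + 1) × (Fin j → Fin m) | ω (x.1, List.ofFn x.2) = true}).preimage hg
  obtain ⟨ρ, hρ⟩ := IsCompact.nonempty_iInter_of_sequence_nonempty_isCompact_isClosed C
    (fun n => Set.biInter_subset_biInter_left (Set.Iic_subset_Iic.2 n.le_succ))
    (fun n => by
      obtain ⟨i, l, hl, hop⟩ := h n
      refine ⟨(i, fun k => l.getD k ⟨0, by omega⟩), Set.mem_iInter₂.2 fun j hj => hop _ ?_⟩
      have hl' : l = List.ofFn fun k : Fin n => l.getD k ⟨0, by omega⟩ := by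
        subst hl
        refine List.ext_getElem (by simp) fun k h1 h2 => ?_
        simp
      conv_rhs => rw [hl']
      exact ofFn_take_prefix _ hj)
    (hclosed 0).isCompact hclosed
  exact ⟨ρ, fun n => Set.mem_iInter₂.1 (Set.mem_iInter.1 hρ n) n Set.self_mem_Iic⟩

/-! ### Local events -/

/-- The event `A` depends only on edges at depth at most `N`. -/
def IsLocal (N : ℕ) (A : Set (Config m)) : Prop :=
  ∀ ω ω' : Config m, (∀ e : Edge m, e.2.length ≤ N → ω e = ω' e) → ω ∈ A → ω' ∈ A

lemma isLocal_openBranch (i : Fin (m + 1)) (w : List (Fin m)) (n : ℕ) :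
    IsLocal (w.length + n) (OpenBranch i w n) := by
  rintro ω ω' h ⟨l, rfl, hω⟩
  refine ⟨l, rfl, fun l' hl' hne => ?_⟩
  rw [← h _ (by simpa using hl'.length_le)]
  exact hω l' hl' hne

lemma isLocal_openStem (i : Fin (m + 1)) (w : List (Fin m)) (n : ℕ) :
    IsLocal (w.length + n) (OpenStem i w) := by
  intro ω ω' h hω l' hl'
  rw [← h _ (hl'.length_le.trans (Nat.le_add_right _ _))]
  exact hω l' hl'

lemma isLocal_rootBranch (n : ℕ) : IsLocal n (RootBranch m n) := by
  rintro ω ω' h ⟨i, l, rfl, hω⟩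
  refine ⟨i, l, rfl, fun l' hl' => ?_⟩
  rw [← h _ hl'.length_le]
  exact hω l' hl'

lemma increasing_openBranch (i : Fin (m + 1)) (w : List (Fin m)) (n : ℕ) :
    IncreasingEvent (OpenBranch i w n) :=
  fun _ _ h ⟨l, hl, hω⟩ => ⟨l, hl, fun l' hl' hne => h _ (hω l' hl' hne)⟩

lemma increasing_openStem (i : Fin (m + 1)) (w : List (Fin m)) :
    IncreasingEvent (OpenStem i w) := fun _ _ h hω l' hl' => h _ (hω l' hl')

/-- The edges at depth at most `N`. -/
noncomputable def edgeBall (m N : ℕ) : Finset (Edge m) :=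
  Finset.univ ×ˢ (List.finite_length_le (Fin m) N).toFinset

lemma mem_edgeBall {N : ℕ} {e : Edge m} : e ∈ edgeBall m N ↔ e.2.length ≤ N := by
  simp [edgeBall]

lemma eventually_subset_edgeFinset (s : Finset (Edge m)) :
    ∀ᶠ Λ : Finset (V m) in atTop, s ⊆ EdgeFinset Λ := by
  classical
  filter_upwards [eventually_ge_atTop (s.image parentV ∪ s.image childV)] with Λ hΛ e he
  exact mem_edgeFinset.2
    ⟨hΛ (Finset.mem_union_left _ (Finset.mem_image_of_mem _ he)),
      hΛ (Finset.mem_union_right _ (Finset.mem_image_of_mem _ he))⟩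

/-- The event on local configurations corresponding to `A`. -/
def localize (Λ : Finset (V m)) (A : Set (Config m)) : Set (LocalCfg Λ) :=
  {σ | patch σ (fun _ => false) ∈ A}

lemma res_preimage_localize {N : ℕ} {A : Set (Config m)} (hA : IsLocal N A) {Λ : Finset (V m)}
    (hΛ : edgeBall m N ⊆ EdgeFinset Λ) : res Λ ⁻¹' localize Λ A = A := by
  ext ω
  have h : ∀ e : Edge m, e.2.length ≤ N → patch (res Λ ω) (fun _ => false) e = ω e := fun e he =>
    patch_mem (res Λ ω) _ ⟨e, hΛ (mem_edgeBall.2 he)⟩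
  exact ⟨hA _ _ h, hA _ _ fun e he => (h e he).symm⟩

lemma isUpperSet_localize {A : Set (Config m)} (hA : IncreasingEvent A) (Λ : Finset (V m)) :
    IsUpperSet (localize Λ A) := by
  intro σ τ hστ hσ
  refine hA _ _ (fun e he => ?_) hσ
  by_cases h : e ∈ EdgeFinset Λ
  · rw [patch_mem σ _ ⟨e, h⟩] at he
    rw [patch_mem τ _ ⟨e, h⟩]
    exact top_le_iff.1 (he.symm.trans_le (hστ _))
  · rwa [patch_notMem _ _ h] at he ⊢

lemma IsLocal.isClopen {N : ℕ} {A : Set (Config m)} (hA : IsLocal N A) : IsClopen A := by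
  obtain ⟨Λ, hΛ⟩ := (eventually_subset_edgeFinset (edgeBall m N)).exists
  rw [← res_preimage_localize hA hΛ]
  exact (isClopen_discrete _).preimage (continuous_pi fun e => continuous_apply e.1)

lemma IsLocal.measurableSet {N : ℕ} {A : Set (Config m)} (hA : IsLocal N A) :
    MeasurableSet A := by
  obtain ⟨Λ, hΛ⟩ := (eventually_subset_edgeFinset (edgeBall m N)).exists
  rw [← res_preimage_localize hA hΛ]
  exact measurable_res Λ (Set.toFinite _).measurableSet

/-! ### Product measures -/

lemma measure_ext_of_cylinders {μ ν : Measure (Config m)} [IsFiniteMeasure μ]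
    (h : ∀ s : Finset (Edge m), ∃ t, s ⊆ t ∧ ∀ η : Config m,
      μ {ω | ∀ e ∈ t, ω e = η e} = ν {ω | ∀ e ∈ t, ω e = η e}) : μ = ν := by
  have key : ∀ A ∈ measurableCylinders (fun _ : Edge m => Bool), μ A = ν A := by
    intro A hA
    obtain ⟨s, B, -, rfl⟩ := (mem_measurableCylinders A).1 hA
    obtain ⟨t, hst, ht⟩ := h s
    let T : Set (t → Bool) := Finset.restrict₂ (π := fun _ : Edge m => Bool) hst ⁻¹' B
    have hT : (T.toFinite.toFinset : Set (t → Bool)) = T := T.toFinite.coe_toFinset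
    have hA : cylinder s B =
        (t.restrict : Config m → t → Bool) ⁻¹' (T.toFinite.toFinset : Set (t → Bool)) := by
      rw [hT]
      rfl
    have hmeas : ∀ y ∈ T.toFinite.toFinset,
        MeasurableSet ((t.restrict : Config m → t → Bool) ⁻¹' {y}) :=
      fun y _ => (Finset.measurable_restrict t) (measurableSet_singleton y)
    rw [hA, ← sum_measure_preimage_singleton _ hmeas, ← sum_measure_preimage_singleton _ hmeas]
    refine Finset.sum_congr rfl fun y _ => ?_
    classical
    have hy : (t.restrict : Config m → t → Bool) ⁻¹' {y} =
        {ω | ∀ e ∈ t, ω e = if h : e ∈ t then y ⟨e, h⟩ else false} := by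
      ext ω
      simp only [Set.mem_preimage, Set.mem_singleton_iff, funext_iff, Finset.restrict,
        Subtype.forall, Set.mem_ofPred_eq]
      exact forall₂_congr fun e he => by rw [dif_pos he]
    rw [hy]
    exact ht _
  refine ext_of_generate_finite _ generateFrom_measurableCylinders.symm
    isPiSystem_measurableCylinders key (key _ ?_)
  exact (mem_measurableCylinders _).2 ⟨∅, Set.univ, MeasurableSet.univ, by simp⟩

lemma preimage_res_singleton (Λ : Finset (V m)) (η : Config m) :
    res Λ ⁻¹' {res Λ η} = {ω | ∀ e ∈ EdgeFinset Λ, ω e = η e} := by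
  ext ω
  simp [res, funext_iff]

section Bernoulli
variable {r : ℝ} {μ : Measure (Config m)}

lemma IsBernoulliProduct.res_singleton (hμ : IsBernoulliProduct r μ) (h0 : 0 ≤ r) (h1 : r ≤ 1)
    {Λ : Finset (V m)} (σ : LocalCfg Λ) :
    μ (res Λ ⁻¹' {σ}) = ENNReal.ofReal (bernWeight r σ) := by
  conv_lhs => rw [← res_patch σ fun _ => false]
  rw [preimage_res_singleton, hμ.2, ← Finset.prod_coe_sort, bernWeight,
    ENNReal.ofReal_prod_of_nonneg fun e _ => by split_ifs <;> linarith]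
  simp_rw [patch_mem]

lemma IsBernoulliProduct.res_preimage (hμ : IsBernoulliProduct r μ) (h0 : 0 ≤ r) (h1 : r ≤ 1)
    {Λ : Finset (V m)} (T : Set (LocalCfg Λ)) :
    μ (res Λ ⁻¹' T) = ENNReal.ofReal (∑ σ, T.indicator (bernWeight r) σ) := by
  classical
  have hT : (T.toFinset : Set (LocalCfg Λ)) = T := T.coe_toFinset
  conv_lhs => rw [← hT]
  rw [← sum_measure_preimage_singleton _
      fun σ _ => measurable_res Λ (measurableSet_singleton σ),
    Finset.sum_congr rfl fun σ _ => hμ.res_singleton h0 h1 σ,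
    ← ENNReal.ofReal_sum_of_nonneg fun σ _ => bernWeight_nonneg h0 h1 σ,
    Finset.sum_indicator_eq_sum_filter]
  congr 2
  ext σ
  simp

/-- A product measure is invariant under resampling the edges of `E_Λ`. -/
lemma IsBernoulliProduct.resample (hμ : IsBernoulliProduct r μ) (h0 : 0 ≤ r) (h1 : r ≤ 1)
    (Λ : Finset (V m)) {A : Set (Config m)} (hA : MeasurableSet A) :
    μ A = ∑ σ : LocalCfg Λ, ENNReal.ofReal (bernWeight r σ) * μ (patch σ ⁻¹' A) := by
  classical
  have := hμ.1
  have key : μ = ∑ σ : LocalCfg Λ, ENNReal.ofReal (bernWeight r σ) • μ.map (patch σ) := by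
    refine measure_ext_of_cylinders fun s => ⟨s ∪ EdgeFinset Λ, Finset.subset_union_left, ?_⟩
    intro η
    have hcyl : MeasurableSet {ω : Config m | ∀ e ∈ s ∪ EdgeFinset Λ, ω e = η e} := by
      have : {ω : Config m | ∀ e ∈ s ∪ EdgeFinset Λ, ω e = η e} =
          ⋂ e ∈ s ∪ EdgeFinset Λ, (fun ω => ω e) ⁻¹' {η e} := by
        ext ω
        simp
      rw [this]
      exact Finset.measurableSet_biInter _ fun e _ =>
        measurable_pi_apply e (measurableSet_singleton _)
    rw [Measure.finsetSum_apply, Finset.sum_eq_single (res Λ η)]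
    · rw [Measure.smul_apply, Measure.map_apply (measurable_patch _) hcyl]
      have hpre : patch (res Λ η) ⁻¹' {ω | ∀ e ∈ s ∪ EdgeFinset Λ, ω e = η e} =
          {ω | ∀ e ∈ (s ∪ EdgeFinset Λ) \ EdgeFinset Λ, ω e = η e} := by
        ext ω
        constructor
        · intro h e he
          rw [Finset.mem_sdiff] at he
          rw [← patch_notMem (res Λ η) ω he.2]
          exact h e he.1
        · intro h e he
          by_cases hΛ : e ∈ EdgeFinset Λ
          · exact patch_mem (res Λ η) ω ⟨e, hΛ⟩
          · rw [patch_notMem _ _ hΛ]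
            exact h e (Finset.mem_sdiff.2 ⟨he, hΛ⟩)
      rw [hpre, hμ.2, hμ.2, smul_eq_mul, ← hμ.res_singleton h0 h1, preimage_res_singleton, hμ.2,
        mul_comm, Finset.prod_sdiff Finset.subset_union_right]
    · intro σ _ hσ
      rw [Measure.smul_apply, Measure.map_apply (measurable_patch _) hcyl]
      have hpre : patch σ ⁻¹' {ω | ∀ e ∈ s ∪ EdgeFinset Λ, ω e = η e} = ∅ := by
        refine Set.eq_empty_of_forall_notMem fun ω h => hσ (funext fun e => ?_)
        rw [← patch_mem σ ω e]
        exact h e (Finset.mem_union_right _ e.2)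
      rw [hpre, measure_empty, smul_zero]
    · simp
  conv_lhs => rw [key]
  rw [Measure.finsetSum_apply]
  refine Finset.sum_congr rfl fun σ _ => ?_
  rw [Measure.smul_apply, Measure.map_apply (measurable_patch σ) hA, smul_eq_mul]

end Bernoulli

/-! ### Domination by the wired measure -/

/-- On every `Λ`, the conditional law under the wired measure given an increasing event
stochastically dominates `φ`. -/
def WiredDominates (p q : ℝ) (φ : Measure (Config m)) : Prop :=
  ∀ (Λ : Finset (V m)) (T T' : Set (LocalCfg Λ)), IsUpperSet T → IsUpperSet T' →
    φ (res Λ ⁻¹' T) * rcFin (wiredRel m) p q Λ (oneCfg m) (res Λ ⁻¹' T') ≤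
      rcFin (wiredRel m) p q Λ (oneCfg m) (res Λ ⁻¹' (T ∩ T'))

section Domination
variable {p q : ℝ} {φ : Measure (Config m)}

lemma ofReal_bdryProb_mul_le (hp0 : 0 ≤ p) (hp1 : p ≤ 1) (hq : 1 ≤ q) {Λ : Finset (V m)}
    {R : V m → V m → Prop} (hR : ∀ u v, R u v → outRel (wiredRel m) Λ (oneCfg m) u v)
    {T T' : Set (LocalCfg Λ)} (hT : IsUpperSet T) (hT' : IsUpperSet T') :
    ENNReal.ofReal (bdryProb R p q T) *
        rcFin (wiredRel m) p q Λ (oneCfg m) (res Λ ⁻¹' T') ≤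
      rcFin (wiredRel m) p q Λ (oneCfg m) (res Λ ⁻¹' (T ∩ T')) := by
  rw [rcFin_res hp0 hp1 hq, rcFin_res hp0 hp1 hq,
    ← ENNReal.ofReal_mul (bdryProb_nonneg hp0 hp1 hq _ _)]
  exact ENNReal.ofReal_le_ofReal (bdryProb_mul_le hp0 hp1 hq hR hT hT')

lemma isProbabilityMeasure_rcFin (hp0 : 0 ≤ p) (hp1 : p ≤ 1) (hq : 1 ≤ q)
    (S : Ray m → Ray m → Prop) (Λ : Finset (V m)) (ξ : Config m) :
    IsProbabilityMeasure (rcFin S p q Λ ξ) := by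
  constructor
  rw [← Set.preimage_univ (f := res Λ), rcFin_res hp0 hp1 hq, bdryProb_univ hp0 hp1 hq,
    ENNReal.ofReal_one]

lemma wiredDominates_of_mem_RCSet (hp0 : 0 ≤ p) (hp1 : p ≤ 1) (hq : 1 ≤ q)
    {S : Ray m → Ray m → Prop} (hφ : φ ∈ RCSet S p q) : WiredDominates p q φ := by
  intro Λ T T' hT hT'
  have := hφ.1
  have h := hφ.2 Λ (res Λ ⁻¹' T) (measurable_res Λ (Set.toFinite T).measurableSet) Set.univ
    MeasurableSet.univ
  have := isProbabilityMeasure_rcFin hp0 hp1 hq (wiredRel m) Λ (oneCfg m)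
  rw [Set.inter_univ, setLIntegral_univ] at h
  rw [h, ← lintegral_mul_const' _ _ (measure_ne_top _ _)]
  refine (lintegral_mono (g := fun _ => rcFin (wiredRel m) p q Λ (oneCfg m)
    (res Λ ⁻¹' (T ∩ T'))) fun ξ => ?_).trans (by simp)
  rw [rcFin_res hp0 hp1 hq S]
  exact ofReal_bdryProb_mul_le hp0 hp1 hq
    (fun u v huv => outRel_mono (fun _ _ _ => trivial) (fun _ _ _ => rfl) huv) hT hT'

lemma density_mem (hp0 : 0 ≤ p) (hp1 : p ≤ 1) (hq : 1 ≤ q) :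
    0 ≤ p / (p + q * (1 - p)) ∧ p / (p + q * (1 - p)) ≤ 1 := by
  have hD : 0 < p + q * (1 - p) := by nlinarith
  refine ⟨by positivity, (div_le_one hD).2 ?_⟩
  nlinarith

lemma wiredDominates_bernoulli (hp0 : 0 ≤ p) (hp1 : p ≤ 1) (hq : 1 ≤ q)
    (hφ : IsBernoulliProduct (p / (p + q * (1 - p))) φ) : WiredDominates p q φ := by
  intro Λ T T' hT hT'
  obtain ⟨h0, h1⟩ := density_mem hp0 hp1 hq
  rw [hφ.res_preimage h0 h1,
    ← bdryProb_of_acyclic (R := fun _ _ => False) hp1 hq (fun _ _ _ _ h => h.elim)]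
  exact ofReal_bdryProb_mul_le hp0 hp1 hq (fun _ _ h => h.elim) hT hT'

lemma WiredDominates.mul_le (h : WiredDominates p q φ) {N : ℕ} {A A' : Set (Config m)}
    (hA : IsLocal N A) (hA' : IsLocal N A') (hAi : IncreasingEvent A) (hAi' : IncreasingEvent A')
    {Λ : Finset (V m)} (hΛ : edgeBall m N ⊆ EdgeFinset Λ) :
    φ A * rcFin (wiredRel m) p q Λ (oneCfg m) A' ≤
      rcFin (wiredRel m) p q Λ (oneCfg m) (A ∩ A') := by
  have := h Λ _ _ (isUpperSet_localize hAi Λ) (isUpperSet_localize hAi' Λ)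
  rwa [Set.preimage_inter, res_preimage_localize hA hΛ, res_preimage_localize hA' hΛ] at this

lemma WiredDominates.le (h : WiredDominates p q φ) (hp0 : 0 ≤ p) (hp1 : p ≤ 1) (hq : 1 ≤ q)
    {N : ℕ} {A : Set (Config m)} (hA : IsLocal N A) (hAi : IncreasingEvent A)
    {Λ : Finset (V m)} (hΛ : edgeBall m N ⊆ EdgeFinset Λ) :
    φ A ≤ rcFin (wiredRel m) p q Λ (oneCfg m) A := by
  have := isProbabilityMeasure_rcFin hp0 hp1 hq (wiredRel m) Λ (oneCfg m)
  simpa using h.mul_le hA (A' := Set.univ) (fun _ _ _ _ => trivial) hAi (fun _ _ _ _ => trivial) hΛ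

lemma WeakLim.tendsto_measure {μs : Finset (V m) → Measure (Config m)}
    (hμs : ∀ Λ, IsProbabilityMeasure (μs Λ)) [IsFiniteMeasure φ] (h : WeakLim μs φ)
    {A : Set (Config m)} (hA : IsClopen A) :
    Tendsto (fun Λ => μs Λ A) atTop (nhds (φ A)) := by
  have hmeas : MeasurableSet A := hA.1.measurableSet
  rw [← ENNReal.tendsto_toReal_iff (fun Λ => measure_ne_top _ _) (measure_ne_top _ _)]
  have := h (BoundedContinuousFunction.indicator A hA)
  simpa [BoundedContinuousFunction.indicator, integral_indicator_one hmeas,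
    Measure.real] using this

/-- A measure dominated by the wired measures has no infinite open branch if the wired limit
has no open ray. -/
lemma WiredDominates.measure_iInter_openBranch (hm : 2 ≤ m) (hp0 : 0 ≤ p) (hp1 : p ≤ 1)
    (hq : 1 ≤ q) {μ ψ : Measure (Config m)} (hμ : IsBernoulliProduct (p / (p + q * (1 - p))) μ)
    [IsProbabilityMeasure ψ]
    (hψ : WeakLim (fun Λ => rcFin (wiredRel m) p q Λ (oneCfg m)) ψ)
    (htheta : ψ {ω | ∃ ρ : Ray m, OpenRay ω ρ} = 0) (h : WiredDominates p q φ)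
    (i : Fin (m + 1)) (w : List (Fin m)) : φ (⋂ n, OpenBranch i w n) = 0 := by
  have hprob := fun Λ => isProbabilityMeasure_rcFin hp0 hp1 hq (wiredRel m) Λ (oneCfg m)
  rcases hp0.eq_or_lt with hp | hp
  · obtain ⟨Λ, hΛ⟩ := (eventually_subset_edgeFinset (edgeBall m (w.length + 1))).exists
    refine measure_mono_null (Set.iInter_subset _ 1) (le_antisymm
      ((h.le hp0 hp1 hq (isLocal_openBranch i w 1) (increasing_openBranch i w 1) hΛ).trans ?_)
      zero_le)
    rw [rcFin_apply hp0 hp1 hq, bdryProb, Finset.sum_eq_zero, zero_div, ENNReal.ofReal_zero]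
    intro σ _
    refine Set.indicator_apply_eq_zero.2 fun ⟨l, hl, hω⟩ => ?_
    have hne : l ≠ [] := by
      rintro rfl
      simp at hl
    have he : (i, w ++ l) ∈ EdgeFinset Λ := hΛ (mem_edgeBall.2 (by simp [hl]))
    have hop := hω l List.prefix_rfl hne
    rw [patch_mem σ _ ⟨_, he⟩] at hop
    rw [bdryWeight, Finset.prod_eq_zero (Finset.mem_univ ⟨_, he⟩) (by rw [if_pos hop, hp]),
      zero_mul]
  · have hD : 0 < p + q * (1 - p) := by nlinarith
    have hstem : μ (OpenStem i w) ≠ 0 := by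
      classical
      have : OpenStem i w = {ω : Config m |
          ∀ e ∈ w.inits.toFinset.image (fun l => (i, l)), ω e = oneCfg m e} := by
        ext ω
        simp [OpenStem, oneCfg]
      rw [this, hμ.2, Finset.prod_ne_zero_iff]
      intro e _
      simpa [oneCfg] using div_pos hp hD
    have hbound : ∀ n, φ (⋂ n, OpenBranch i w n) * μ (OpenStem i w) ≤
        ψ (RootBranch m (w.length + n)) := by
      intro n
      refine ge_of_tendsto (hψ.tendsto_measure hprob (isLocal_rootBranch _).isClopen) ?_
      filter_upwards [eventually_subset_edgeFinset (edgeBall m (w.length + n))] with Λ hΛ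
      calc φ (⋂ n, OpenBranch i w n) * μ (OpenStem i w)
          ≤ φ (OpenBranch i w n) * rcFin (wiredRel m) p q Λ (oneCfg m) (OpenStem i w) :=
            mul_le_mul' (measure_mono (Set.iInter_subset _ n))
              ((wiredDominates_bernoulli hp0 hp1 hq hμ).le hp0 hp1 hq (isLocal_openStem i w n)
                (increasing_openStem i w) hΛ)
        _ ≤ rcFin (wiredRel m) p q Λ (oneCfg m) (OpenBranch i w n ∩ OpenStem i w) :=
            h.mul_le (isLocal_openBranch i w n) (isLocal_openStem i w n)
              (increasing_openBranch i w n) (increasing_openStem i w) hΛ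
        _ ≤ _ := measure_mono (openBranch_inter_openStem_subset i w n)
    have hanti : Antitone fun n => RootBranch m n := by
      refine antitone_nat_of_succ_le fun n => ?_
      rintro ω ⟨i, l, hl, hω⟩
      exact ⟨i, l.take n, by simp [hl], fun l' hl' => hω l' (hl'.trans (List.take_prefix _ _))⟩
    have hlim : Tendsto (fun n => ψ (RootBranch m n)) atTop (nhds 0) := by
      have hnull : ψ (⋂ n, RootBranch m n) = 0 :=
        measure_mono_null (fun ω hω => exists_openRay hm (Set.mem_iInter.1 hω)) htheta
      rw [← hnull]
      exact tendsto_measure_iInter_atTop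
        (fun n => (isLocal_rootBranch n).measurableSet.nullMeasurableSet) hanti
        ⟨0, measure_ne_top _ _⟩
    have hlim' : Tendsto (fun n => ψ (RootBranch m (w.length + n))) atTop (nhds 0) := by
      simp_rw [add_comm w.length]
      exact (tendsto_add_atTop_iff_nat w.length).2 hlim
    have := ge_of_tendsto' hlim' hbound
    exact (mul_eq_zero.1 (le_antisymm this zero_le)).resolve_right hstem

/-! ### Boundary conditions without infinite paths -/

lemma acyclic_outConn (Λ : Finset (V m)) (ξ : Config m) :
    Acyclic (OutConn (↑Λ : Set (V m)) ξ) Λ := by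
  rintro e he u v ⟨n, f, rfl, rfl, hf⟩
  induction n with
  | zero => rfl
  | succ n ih =>
    obtain ⟨g, -, hg, hends⟩ := hf n n.lt_succ_self
    refine (ih fun i hi => hf i (hi.trans n.lt_succ_self)).trans (anc_endsAt_iff ?_ hends)
    rintro rfl
    exact hg (mem_edgeFinset.1 he)

lemma acyclic_outRel {ξ : Config m} (hξ : ∀ i w, ξ ∉ ⋂ n, OpenBranch i w n)
    (S : Ray m → Ray m → Prop) (Λ : Finset (V m)) : Acyclic (outRel S Λ ξ) Λ := by
  rintro e he u v (h | ⟨πu, -, -, hu, -⟩)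
  · exact acyclic_outConn Λ ξ e he u v h
  · obtain ⟨i, w, hiw⟩ := IPath.exists_openBranch hu
    exact absurd (Set.mem_iInter.2 hiw) (hξ i w)

lemma ae_rcFin_eq (hp0 : 0 ≤ p) (hp1 : p ≤ 1) (hq : 1 ≤ q) (S : Ray m → Ray m → Prop)
    (h : ∀ (i : Fin (m + 1)) (w : List (Fin m)), φ (⋂ n, OpenBranch i w n) = 0)
    (Λ : Finset (V m)) (A : Set (Config m)) :
    ∀ᵐ ξ ∂φ, rcFin S p q Λ ξ A = ENNReal.ofReal (∑ σ : LocalCfg Λ,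
      {σ | patch σ ξ ∈ A}.indicator (bernWeight (p / (p + q * (1 - p)))) σ) := by
  have hae : ∀ᵐ ξ ∂φ, ∀ i w, ξ ∉ ⋂ n, OpenBranch i w n :=
    ae_all_iff.2 fun i => ae_all_iff.2 fun w => measure_eq_zero_iff_ae_notMem.1 (h i w)
  filter_upwards [hae] with ξ hξ
  rw [rcFin_apply hp0 hp1 hq, bdryProb_of_acyclic hp1 hq (acyclic_outRel hξ S Λ)]

lemma eq_bernoulli_of_mem_RCSet (hp0 : 0 ≤ p) (hp1 : p ≤ 1) (hq : 1 ≤ q)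
    {S : Ray m → Ray m → Prop} (hφ : φ ∈ RCSet S p q)
    (h : ∀ (i : Fin (m + 1)) (w : List (Fin m)), φ (⋂ n, OpenBranch i w n) = 0)
    {μ : Measure (Config m)} (hμ : IsBernoulliProduct (p / (p + q * (1 - p))) μ) : φ = μ := by
  have := hφ.1
  obtain ⟨h0, h1⟩ := density_mem hp0 hp1 hq
  refine measure_ext_of_cylinders fun s => ?_
  obtain ⟨Λ, hΛ⟩ := (eventually_subset_edgeFinset s).exists
  refine ⟨EdgeFinset Λ, hΛ, fun η => ?_⟩
  rw [← preimage_res_singleton]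
  have hRC := hφ.2 Λ _ (measurable_res Λ (measurableSet_singleton (res Λ η))) Set.univ
    MeasurableSet.univ
  rw [Set.inter_univ, setLIntegral_univ, lintegral_congr_ae (ae_rcFin_eq hp0 hp1 hq S h Λ _)] at hRC
  rw [hRC, hμ.res_preimage h0 h1]
  simp [res_patch]

lemma bernoulli_mem_RCSet (hp0 : 0 ≤ p) (hp1 : p ≤ 1) (hq : 1 ≤ q) (S : Ray m → Ray m → Prop)
    (h : ∀ (i : Fin (m + 1)) (w : List (Fin m)), φ (⋂ n, OpenBranch i w n) = 0)
    (hφ : IsBernoulliProduct (p / (p + q * (1 - p))) φ) : φ ∈ RCSet S p q := by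
  obtain ⟨h0, h1⟩ := density_mem hp0 hp1 hq
  refine ⟨hφ.1, fun Λ A hA B hB => ?_⟩
  obtain ⟨C, hC, rfl⟩ := hB
  set B := (fun (ω : Config m) (e : {e : Edge m // e ∉ EdgeFinset Λ}) => ω ↑e) ⁻¹' C
  have hBm : MeasurableSet B :=
    measurable_pi_lambda _ (fun e => measurable_pi_apply e.1) hC
  have hpatch : ∀ σ : LocalCfg Λ, patch σ ⁻¹' B = B := by
    intro σ
    ext ξ
    have : (fun e : {e : Edge m // e ∉ EdgeFinset Λ} => patch σ ξ e.1) =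
        fun e : {e : Edge m // e ∉ EdgeFinset Λ} => ξ e.1 :=
      funext fun e => patch_notMem σ ξ e.2
    simp only [B, Set.mem_preimage, this]
  have hint : ∀ᵐ ξ ∂φ.restrict B, rcFin S p q Λ ξ A = ∑ σ : LocalCfg Λ,
      ENNReal.ofReal (bernWeight (p / (p + q * (1 - p))) σ) *
        (patch σ ⁻¹' A).indicator 1 ξ := by
    filter_upwards [ae_restrict_of_ae (ae_rcFin_eq hp0 hp1 hq S h Λ A)] with ξ hξ
    rw [hξ, ENNReal.ofReal_sum_of_nonneg fun σ _ =>
      Set.indicator_nonneg (fun τ _ => bernWeight_nonneg h0 h1 τ) σ]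
    refine Finset.sum_congr rfl fun σ _ => ?_
    by_cases hσ : patch σ ξ ∈ A
    · rw [Set.indicator_of_mem (by exact hσ), Set.indicator_of_mem (by exact hσ), Pi.one_apply,
        mul_one]
    · rw [Set.indicator_of_notMem (by exact hσ), Set.indicator_of_notMem (by exact hσ), mul_zero,
        ENNReal.ofReal_zero]
  rw [hφ.resample h0 h1 Λ (hA.inter hBm), lintegral_congr_ae hint, lintegral_finsetSum]
  · refine Finset.sum_congr rfl fun σ _ => ?_
    have hAm := measurable_patch σ hA
    rw [lintegral_const_mul _ (measurable_one.indicator hAm), lintegral_indicator_one hAm,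
      Measure.restrict_apply hAm, Set.preimage_inter, hpatch]
  · exact fun σ _ => (measurable_one.indicator (measurable_patch σ hA)).const_mul _

end Domination

/-- For a closed equivalence relation `∼`, `q ≥ 1`, and `p ∈ [0,1]` with
`θ¹(p,q) = 0` (a.s. there is no infinite open path from the root under the wired limit
measure), the set `R^∼_{p,q}` comprises the product measure `φ_π` only. -/
theorem rc_unique_when_theta_zero (m : ℕ) (hm : 2 ≤ m) (S : Ray m → Ray m → Prop)
    (hequiv : Equivalence S) (hclosed : IsClosedRel S)
    (p q : ℝ) (hp0 : 0 ≤ p) (hp1 : p ≤ 1) (hq : 1 ≤ q)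
    (pi : ℝ) (hpi : pi = p / (p + q * (1 - p)))
    (phipi : Measure (Config m)) (hphipi : IsBernoulliProduct pi phipi)
    (ψw : Measure (Config m)) (hψwprob : IsProbabilityMeasure ψw)
    (hψw : WeakLim (fun Λ => rcFin (wiredRel m) p q Λ (oneCfg m)) ψw)
    (htheta : ψw {ω | ∃ ρ : Ray m, OpenRay ω ρ} = 0) :
    RCSet S p q = {phipi} := by
  subst hpi
  have hnull : ∀ {φ : Measure (Config m)}, WiredDominates p q φ →
      ∀ (i : Fin (m + 1)) (w : List (Fin m)), φ (⋂ n, OpenBranch i w n) = 0 :=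
    fun h => h.measure_iInter_openBranch hm hp0 hp1 hq hphipi hψw htheta
  refine Set.eq_singleton_iff_unique_mem.2 ⟨?_, fun φ hφ => ?_⟩
  · exact bernoulli_mem_RCSet hp0 hp1 hq S
      (hnull (wiredDominates_bernoulli hp0 hp1 hq hphipi)) hphipi
  · exact eq_bernoulli_of_mem_RCSet hp0 hp1 hq hφ
      (hnull (wiredDominates_of_mem_RCSet hp0 hp1 hq hφ)) hphipi

end RCTree
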